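/- arXiv:2603.19560 — 3 statements merged into one kernel-verified Lean document; each statement's English description precedes it below -/
import Mathlib

section
/- (Shortcut Existence) If a term t₁ steps to a term t₂ by rule r₁ = (p₁ ↦ p₂), and t₂ steps to a term t₃ by rule r₂ = (p₃ ↦ p₄), then the pair of patterns (p₂, p₃) has a most general unifier; consequently the composition r₁ ∘ r₂ exists. -/
inductive Pattern (K X : Type) : Type
  | var : X → Pattern K X
  | con : K → List (Pattern K X) → Pattern K X

abbrev Subst (K X : Type) : Type := X → Pattern K X

def Pattern.subst {K X : Type} (σ : Subst K X) : Pattern K X → Pattern K X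
  | .var x => σ x
  | .con k ps => .con k (ps.attach.map fun q => Pattern.subst σ q.1)
termination_by p => sizeOf p
decreasing_by
  have := List.sizeOf_lt_of_mem q.2
  simp only [Pattern.con.sizeOf_spec]
  omega

def scomp {K X : Type} (σ₁ σ₂ : Subst K X) : Subst K X :=
  fun x => (σ₂ x).subst σ₁

def Factors {K X : Type} (σ₁ σ₂ : Subst K X) : Prop :=
  ∃ σ₃, σ₁ = scomp σ₃ σ₂

def Unifies {K X : Type} (σ₁ σ₂ : Subst K X) (p₁ p₂ : Pattern K X) : Prop :=
  p₁.subst σ₁ = p₂.subst σ₂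

def IsMGU {K X : Type} (σ₁ σ₂ : Subst K X) (p₁ p₂ : Pattern K X) : Prop :=
  Unifies σ₁ σ₂ p₁ p₂ ∧
  ∀ σ₁' σ₂' : Subst K X, Unifies σ₁' σ₂' p₁ p₂ → Factors σ₁' σ₁ ∧ Factors σ₂' σ₂

inductive IsGround {K X : Type} : Pattern K X → Prop
  | con (k : K) (ps : List (Pattern K X)) : (∀ p ∈ ps, IsGround p) → IsGround (.con k ps)

inductive VarOccurs {K X : Type} (x : X) : Pattern K X → Prop
  | var : VarOccurs x (.var x)
  | con (k : K) (ps : List (Pattern K X)) (p : Pattern K X) :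
      p ∈ ps → VarOccurs x p → VarOccurs x (.con k ps)

abbrev Rule (K X : Type) : Type := Pattern K X × Pattern K X

def Functional {K X : Type} (r : Rule K X) : Prop :=
  ∀ x, VarOccurs x r.2 → VarOccurs x r.1

def Step {K X : Type} (r : Rule K X) (t₁ t₂ : Pattern K X) : Prop :=
  ∃ σ : Subst K X, r.1.subst σ = t₁ ∧ r.2.subst σ = t₂

def ComposedBy {K X : Type} (r₁ r₂ r : Rule K X) : Prop :=
  ∃ σ₁ σ₂ : Subst K X, IsMGU σ₁ σ₂ r₁.2 r₂.1 ∧ r = (r₁.1.subst σ₁, r₂.2.subst σ₂)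

def RuleEquiv {K X : Type} (r r' : Rule K X) : Prop :=
  ∃ σ₁ σ₂ : Subst K X,
    r.1.subst σ₁ = r'.1 ∧ r.2.subst σ₁ = r'.2 ∧
    r'.1.subst σ₂ = r.1 ∧ r'.2.subst σ₂ = r.2

def StepSet {K X : Type} (R : Set (Rule K X)) (t₁ t₂ : Pattern K X) : Prop :=
  ∃ r ∈ R, Step r t₁ t₂

def Evaluates {K X : Type} (R : Set (Rule K X)) (t₁ t₂ : Pattern K X) : Prop :=
  Relation.ReflTransGen (StepSet R) t₁ t₂ ∧ ∀ t₃, ¬ StepSet R t₂ t₃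

namespace Pattern

variable {K X : Type}

theorem subst_con (σ : Subst K X) (k : K) (ps : List (Pattern K X)) :
    (con k ps).subst σ = con k (ps.map (subst σ)) := by
  rw [subst, List.attach_map_val (f := subst σ)]

theorem subst_var (σ : Subst K X) (x : X) : (var x).subst σ = σ x := by
  rw [subst]

theorem induction_mem {P : Pattern K X → Prop} (var : ∀ x, P (.var x))
    (con : ∀ k ps, (∀ p ∈ ps, P p) → P (.con k ps)) : ∀ p, P p
  | .var x => var x
  | .con k ps => con k ps fun p _ => induction_mem var con p

theorem subst_congr {σ τ : Subst K X} (p : Pattern K X)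
    (h : ∀ x, VarOccurs x p → σ x = τ x) : p.subst σ = p.subst τ := by
  induction p using induction_mem with
  | var x => simpa only [subst_var] using h x .var
  | con k ps ih =>
    simp only [subst_con, con.injEq, true_and]
    exact List.map_congr_left fun p hp => ih p hp fun x hx => h x (.con k ps p hp hx)

theorem subst_id (p : Pattern K X) : p.subst var = p := by
  induction p using induction_mem with
  | var x => exact subst_var _ x
  | con k ps ih =>
    simp only [subst_con, con.injEq, true_and]
    exact (List.map_congr_left ih).trans (List.map_id ps)

theorem subst_subst (σ τ : Subst K X) (p : Pattern K X) :
    (p.subst τ).subst σ = p.subst (scomp σ τ) := by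
  induction p using induction_mem with
  | var x => simp only [subst_var, scomp]
  | con k ps ih =>
    simp only [subst_con, con.injEq, true_and, List.map_map]
    exact List.map_congr_left ih

theorem sizeOf_pos (p : Pattern K X) : 0 < sizeOf p := by
  cases p <;> simp only [var.sizeOf_spec, con.sizeOf_spec] <;> omega

theorem sizeOf_le_of_varOccurs (σ : Subst K X) {x : X} {p : Pattern K X} (h : VarOccurs x p) :
    sizeOf (σ x) ≤ sizeOf (p.subst σ) := by
  induction h with
  | var => rw [subst_var]
  | con k ps p hp _ ih =>
    have := List.sizeOf_lt_of_mem (List.mem_map_of_mem (f := subst σ) hp)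
    rw [subst_con, con.sizeOf_spec]
    omega

theorem eq_var_of_varOccurs {σ : Subst K X} {x : X} {p : Pattern K X}
    (hσ : σ x = p.subst σ) (h : VarOccurs x p) : p = var x := by
  cases h with
  | var => rfl
  | con k ps p hp h =>
    have h₁ := sizeOf_le_of_varOccurs σ h
    have h₂ := List.sizeOf_lt_of_mem (List.mem_map_of_mem (f := subst σ) hp)
    rw [hσ, subst_con, con.sizeOf_spec] at h₁
    omega

theorem sum_sizeOf_le (ps : List (Pattern K X)) : (ps.map sizeOf).sum ≤ sizeOf ps := by
  induction ps with
  | nil => simp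
  | cons p ps ih =>
    simp only [List.map_cons, List.sum_cons, List.cons.sizeOf_spec]
    omega

end Pattern

open Pattern

/-- `σ` solves every equation of the list `E`. -/
def Solves {K X : Type} (σ : Subst K X) (E : List (Pattern K X × Pattern K X)) : Prop :=
  ∀ e ∈ E, e.1.subst σ = e.2.subst σ

/-- `θ` solves `E`, and every solution of `E` factors through `θ` by itself. -/
def IsSolvedForm {K X : Type} (θ : Subst K X) (E : List (Pattern K X × Pattern K X)) : Prop :=
  Solves θ E ∧ ∀ σ, Solves σ E → scomp σ θ = σ

/-- The total size of the left-hand sides of `E` under `σ`. -/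
noncomputable def instanceSize {K X : Type} (σ : Subst K X) (E : List (Pattern K X × Pattern K X)) : ℕ :=
  (E.map fun e => sizeOf (e.1.subst σ)).sum

section Unification

variable {K X : Type}

theorem IsSolvedForm.congr {θ : Subst K X} {E E' : List (Pattern K X × Pattern K X)}
    (h : IsSolvedForm θ E) (hE : ∀ σ, Solves σ E ↔ Solves σ E') : IsSolvedForm θ E' :=
  ⟨(hE θ).1 h.1, fun σ hσ => h.2 σ ((hE σ).2 hσ)⟩

theorem solves_cons {σ : Subst K X} {p q : Pattern K X} {E : List (Pattern K X × Pattern K X)} :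
    Solves σ ((p, q) :: E) ↔ p.subst σ = q.subst σ ∧ Solves σ E :=
  List.forall_mem_cons

theorem solves_append {σ : Subst K X} {E E' : List (Pattern K X × Pattern K X)} :
    Solves σ (E ++ E') ↔ Solves σ E ∧ Solves σ E' :=
  List.forall_mem_append

theorem solves_zip {σ : Subst K X} {ps qs : List (Pattern K X)} (h : ps.length = qs.length) :
    Solves σ (ps.zip qs) ↔ ps.map (subst σ) = qs.map (subst σ) := by
  induction ps generalizing qs with
  | nil => cases qs <;> simp_all [Solves]
  | cons p ps ih =>
    cases qs with
    | nil => simp at h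
    | cons q qs =>
      rw [List.zip_cons_cons, solves_cons, ih (by simpa using h)]
      simp

/-- Apply a substitution to both sides of every equation. -/
def substEqs (τ : Subst K X) (E : List (Pattern K X × Pattern K X)) :
    List (Pattern K X × Pattern K X) :=
  E.map fun e => (e.1.subst τ, e.2.subst τ)

theorem solves_substEqs {σ τ : Subst K X} {E : List (Pattern K X × Pattern K X)} :
    Solves σ (substEqs τ E) ↔ Solves (scomp σ τ) E := by
  simp only [Solves, substEqs, List.forall_mem_map, subst_subst]

theorem instanceSize_substEqs (σ τ : Subst K X) (E : List (Pattern K X × Pattern K X)) :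
    instanceSize σ (substEqs τ E) = instanceSize (scomp σ τ) E := by
  simp [instanceSize, substEqs, subst_subst, Function.comp_def]

theorem scomp_assoc (σ τ ρ : Subst K X) : scomp σ (scomp τ ρ) = scomp (scomp σ τ) ρ :=
  funext fun x => subst_subst σ τ (ρ x)

open Classical in
theorem scomp_update_eq {σ : Subst K X} {x : X} {t : Pattern K X} (h : σ x = t.subst σ) :
    scomp σ (Function.update var x t) = σ := by
  funext y
  by_cases hy : y = x
  · subst hy
    simp [scomp, h]
  · simp [scomp, hy, subst_var]

open Classical in
theorem IsSolvedForm.cons_var {x : X} {t : Pattern K X} {θ : Subst K X}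
    {E : List (Pattern K X × Pattern K X)} (hx : ¬ VarOccurs x t)
    (h : IsSolvedForm θ (substEqs (Function.update var x t) E)) :
    IsSolvedForm (scomp θ (Function.update var x t)) ((var x, t) :: E) := by
  refine ⟨solves_cons.2 ⟨?_, solves_substEqs.1 h.1⟩, fun σ hσ => ?_⟩
  · have ht : t.subst (Function.update var x t) = t := by
      refine (subst_congr t fun y hy => ?_).trans (subst_id t)
      exact Function.update_of_ne (by rintro rfl; exact hx hy) _ _
    rw [← subst_subst, ← subst_subst, ht, subst_var, Function.update_self]
  · obtain ⟨hxt, hE⟩ := solves_cons.1 hσ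
    have hu := scomp_update_eq (hxt ▸ subst_var σ x).symm
    rw [scomp_assoc, h.2 σ (solves_substEqs.2 (hu.symm ▸ hE)), hu]

theorem exists_isSolvedForm {σ : Subst K X} {E : List (Pattern K X × Pattern K X)}
    (hσ : Solves σ E) : ∃ θ, IsSolvedForm θ E := by
  classical
  induction hn : instanceSize σ E using Nat.strong_induction_on generalizing E with
  | _ n ih =>
  subst hn
  rcases E with _ | ⟨⟨p, q⟩, E⟩
  · exact ⟨var, by simp [Solves], fun σ _ => funext fun x => subst_var σ x⟩
  obtain ⟨hpq, hE⟩ := solves_cons.1 hσ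
  have hlt : instanceSize σ E < instanceSize σ ((p, q) :: E) := by
    have := sizeOf_pos (p.subst σ)
    simp only [instanceSize, List.map_cons, List.sum_cons]
    omega
  have eliminate (x : X) (t : Pattern K X) (ht : σ x = t.subst σ) :
      ∃ θ, IsSolvedForm θ ((var x, t) :: E) := by
    by_cases hx : VarOccurs x t
    · obtain ⟨θ, hθ⟩ := ih _ hlt hE rfl
      refine ⟨θ, hθ.congr fun σ => ?_⟩
      simp [solves_cons, eq_var_of_varOccurs ht hx]
    · have hu := scomp_update_eq ht
      obtain ⟨θ, hθ⟩ := ih (instanceSize σ (substEqs (Function.update var x t) E))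
        (by rwa [instanceSize_substEqs, hu]) (solves_substEqs.2 (hu.symm ▸ hE)) rfl
      exact ⟨_, hθ.cons_var hx⟩
  cases p with
  | var x => exact eliminate x q (by rwa [subst_var] at hpq)
  | con k ps =>
    cases q with
    | var x =>
      obtain ⟨θ, hθ⟩ := eliminate x (con k ps) (by rw [hpq, subst_var])
      exact ⟨θ, hθ.congr fun σ => by simp only [solves_cons, eq_comm]⟩
    | con k' qs =>
      simp only [subst_con, con.injEq] at hpq
      obtain ⟨rfl, hmap⟩ := hpq
      have hlen : ps.length = qs.length := by simpa using congrArg List.length hmap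
      have hsize : instanceSize σ (ps.zip qs ++ E) < instanceSize σ ((con k ps, con k qs) :: E) := by
        have h₁ := sum_sizeOf_le (ps.map (subst σ))
        have h₂ : (ps.zip qs).map (fun e => sizeOf (e.1.subst σ)) =
            (ps.map (subst σ)).map sizeOf := by
          conv_rhs => rw [← List.map_fst_zip hlen.le]
          simp
        simp only [instanceSize, List.map_append, List.sum_append, h₂, List.map_cons,
          List.sum_cons, subst_con, con.sizeOf_spec]
        omega
      obtain ⟨θ, hθ⟩ := ih _ hsize (solves_append.2 ⟨(solves_zip hlen).2 hmap, hE⟩) rfl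
      refine ⟨θ, hθ.congr fun σ => ?_⟩
      simp [solves_cons, solves_append, solves_zip hlen, subst_con]

theorem exists_isMGU [Countable X] [Infinite X] {σ₁ σ₂ : Subst K X} {p q : Pattern K X}
    (h : Unifies σ₁ σ₂ p q) : ∃ θ₁ θ₂ : Subst K X, IsMGU θ₁ θ₂ p q := by
  obtain ⟨e⟩ : Nonempty (X ⊕ X ≃ X) := nonempty_equiv_of_countable
  let l : Subst K X := fun x => var (e (.inl x))
  let r : Subst K X := fun x => var (e (.inr x))
  let join (τ₁ τ₂ : Subst K X) : Subst K X := fun x => Sum.elim τ₁ τ₂ (e.symm x)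
  have hl (τ₁ τ₂ : Subst K X) : scomp (join τ₁ τ₂) l = τ₁ := by
    funext x; simp [scomp, l, join, subst_var]
  have hr (τ₁ τ₂ : Subst K X) : scomp (join τ₁ τ₂) r = τ₂ := by
    funext x; simp [scomp, r, join, subst_var]
  have hjoin {τ₁ τ₂ : Subst K X} (hτ : Unifies τ₁ τ₂ p q) :
      Solves (join τ₁ τ₂) [(p.subst l, q.subst r)] := by
    simpa [Unifies, Solves, subst_subst, hl, hr] using hτ
  obtain ⟨θ, hθ, hmax⟩ := exists_isSolvedForm (hjoin h)
  refine ⟨scomp θ l, scomp θ r, ?_, fun τ₁ τ₂ hτ => ⟨⟨join τ₁ τ₂, ?_⟩, ⟨join τ₁ τ₂, ?_⟩⟩⟩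
  · simpa [Unifies, Solves, subst_subst] using hθ
  · rw [scomp_assoc, hmax _ (hjoin hτ), hl]
  · rw [scomp_assoc, hmax _ (hjoin hτ), hr]

end Unification

theorem shortcut_existence {K X : Type} [Countable X] [Infinite X]
    (p₁ p₂ p₃ p₄ t₁ t₂ t₃ : Pattern K X)
    (hg₁ : IsGround t₁) (hg₂ : IsGround t₂) (hg₃ : IsGround t₃)
    (s₁ : Step (p₁, p₂) t₁ t₂) (s₂ : Step (p₃, p₄) t₂ t₃) :
    (∃ σ₁ σ₂ : Subst K X, IsMGU σ₁ σ₂ p₂ p₃) ∧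
    (∃ r : Rule K X, ComposedBy (p₁, p₂) (p₃, p₄) r) := by
  obtain ⟨τ₁, -, h₁⟩ := s₁
  obtain ⟨τ₂, h₂, -⟩ := s₂
  obtain ⟨σ₁, σ₂, h⟩ := exists_isMGU (h₁.trans h₂.symm)
  exact ⟨⟨σ₁, σ₂, h⟩, _, σ₁, σ₂, h, rfl⟩
end

section
/- (Decomposition of composed steps) Let r₁ = (p₁ ↦ p₂) and r₂ = (p₃ ↦ p₄) be rewrite rules with r₁ functional, and suppose the composition r₁ ∘ r₂ exists. If a term t₁ steps to a term t₂ by r₁ ∘ r₂, then there exists a term t′ such that t₁ steps to t′ by r₁ and t′ steps to t₂ by r₂. -/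
theorem Pattern.subst_var_s4 {K X : Type} (σ : Subst K X) (x : X) :
    (Pattern.var x).subst σ = σ x := by
  rw [Pattern.subst]

theorem Pattern.subst_con_s4 {K X : Type} (σ : Subst K X) (k : K) (ps : List (Pattern K X)) :
    (Pattern.con k ps).subst σ = .con k (ps.map (Pattern.subst σ)) := by
  rw [Pattern.subst]
  simp

theorem Pattern.subst_scomp {K X : Type} (σ τ : Subst K X) :
    ∀ p : Pattern K X, p.subst (scomp σ τ) = (p.subst τ).subst σ
  | .var x => by rw [subst_var_s4, subst_var_s4, scomp]
  | .con k ps => by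
    simp only [subst_con_s4, List.map_map, Pattern.con.injEq, true_and]
    exact List.map_congr_left fun q hq => subst_scomp σ τ q
termination_by p => sizeOf p
decreasing_by
  have := List.sizeOf_lt_of_mem hq
  simp only [Pattern.con.sizeOf_spec]
  omega

theorem VarOccurs.isGround_of_subst {K X : Type} {σ : Subst K X} {x : X} {p : Pattern K X}
    (hx : VarOccurs x p) (hp : IsGround (p.subst σ)) : IsGround (σ x) := by
  induction hx with
  | var => rwa [Pattern.subst_var_s4] at hp
  | con k ps q hq _ ih =>
    rw [Pattern.subst_con_s4] at hp
    cases hp with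
    | con _ _ h => exact ih (h _ (List.mem_map_of_mem hq))

theorem IsGround.subst_of_forall_varOccurs {K X : Type} {σ : Subst K X} :
    ∀ p : Pattern K X, (∀ x, VarOccurs x p → IsGround (σ x)) → IsGround (p.subst σ)
  | .var x, h => by
    rw [Pattern.subst_var_s4]
    exact h x .var
  | .con k ps, h => by
    rw [Pattern.subst_con_s4]
    refine .con _ _ fun p hp => ?_
    obtain ⟨q, hq, rfl⟩ := List.mem_map.1 hp
    exact subst_of_forall_varOccurs q fun x hx => h x (.con k ps q hq hx)
termination_by p => sizeOf p
decreasing_by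
  have := List.sizeOf_lt_of_mem hq
  simp only [Pattern.con.sizeOf_spec]
  omega

theorem composed_step_decompose {K X : Type} [Countable X] [Infinite X]
    (p₁ p₂ p₃ p₄ : Pattern K X) (hfun : Functional (p₁, p₂))
    (σ₁ σ₂ : Subst K X) (hmgu : IsMGU σ₁ σ₂ p₂ p₃)
    (t₁ t₂ : Pattern K X) (hg₁ : IsGround t₁) (hg₂ : IsGround t₂)
    (h : Step (p₁.subst σ₁, p₄.subst σ₂) t₁ t₂) :
    ∃ t' : Pattern K X, IsGround t' ∧ Step (p₁, p₂) t₁ t' ∧ Step (p₃, p₄) t' t₂ := by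
  obtain ⟨σ, h₁, h₂⟩ := h
  rw [← Pattern.subst_scomp] at h₁ h₂
  refine ⟨p₂.subst (scomp σ σ₁), ?_, ⟨scomp σ σ₁, h₁, rfl⟩, ⟨scomp σ σ₂, ?_, h₂⟩⟩
  · exact .subst_of_forall_varOccurs p₂ fun x hx =>
      (hfun x hx).isGround_of_subst (h₁ ▸ hg₁)
  · have hu : p₂.subst σ₁ = p₃.subst σ₂ := hmgu.1
    simp only [Pattern.subst_scomp, hu]
end

section
/- (Preservation of normal forms) Let r₁ = (p₁ ↦ p₂) and r₂ = (p₃ ↦ p₄) be rewrite rules with r₁ functional, and suppose the composition r₁ ∘ r₂ exists. If a term t does not step by r₁ (i.e., there is no term t′ with t ↦_{r₁} t′), then t does not step by r₁ ∘ r₂. -/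
theorem Pattern.subst_subst_s6 {K X : Type} (σ₁ σ₂ : Subst K X) :
    ∀ p : Pattern K X, (p.subst σ₂).subst σ₁ = p.subst (scomp σ₁ σ₂)
  | .var x => by simp only [Pattern.subst, scomp]
  | .con k ps => by
    have ih : ∀ q ∈ ps, (q.subst σ₂).subst σ₁ = q.subst (scomp σ₁ σ₂) :=
      fun q _ => Pattern.subst_subst_s6 σ₁ σ₂ q
    simpa [Pattern.subst] using ih
termination_by p => sizeOf p
decreasing_by
  have := List.sizeOf_lt_of_mem ‹q ∈ ps›
  simp only [Pattern.con.sizeOf_spec]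
  omega

theorem composed_preserves_normal_forms {K X : Type} [Countable X] [Infinite X]
    (p₁ p₂ p₃ p₄ : Pattern K X) (hfun : Functional (p₁, p₂))
    (σ₁ σ₂ : Subst K X) (hmgu : IsMGU σ₁ σ₂ p₂ p₃)
    (t : Pattern K X) (hg : IsGround t)
    (hns : ∀ t' : Pattern K X, ¬ Step (p₁, p₂) t t') :
    ∀ t' : Pattern K X, ¬ Step (p₁.subst σ₁, p₄.subst σ₂) t t' := by
  rintro t' ⟨σ, h, -⟩
  exact hns _ ⟨scomp σ σ₁, (Pattern.subst_subst_s6 σ σ₁ p₁).symm.trans h, rfl⟩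
end
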